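/- Consider the low-recourse dynamic greedy spanner: starting from empty G and H, each inserted edge (u,v) is added to H iff dist_H(u,v) > 2 log n, and each deletion of an edge of H triggers re-processing of all edges of E(G)\E(H). If there are at most n deletions total, then the total recourse (number of edge changes) of H is O(n). -/

import Mathlib

namespace SpannerAux

open SimpleGraph

/-- All cycles are longer than `k`. -/
def LongCycles {V : Type*} (G : SimpleGraph V) (k : ℕ) : Prop :=
  ∀ (v : V) (c : G.Walk v v), c.IsCycle → k < c.length

theorem path_unique {V : Type*} {G : SimpleGraph V} {k : ℕ} (hG : LongCycles G k)
    {u v : V} (p q : G.Walk u v) (hp : p.IsPath) (hq : q.IsPath)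
    (hk : p.length + q.length ≤ k) : p = q := by
  classical
  let F : SimpleGraph V := fromEdgeSet {e | e ∈ p.edges ∨ e ∈ q.edges}
  have hpF : ∀ e ∈ p.edges, e ∈ F.edgeSet := by
    intro e he
    have := G.not_isDiag_of_mem_edgeSet (p.edges_subset_edgeSet he)
    simp [F, he, this]
  have hqF : ∀ e ∈ q.edges, e ∈ F.edgeSet := by
    intro e he
    have := G.not_isDiag_of_mem_edgeSet (q.edges_subset_edgeSet he)
    simp [F, he, this]
  have hFe : ∀ e ∈ F.edgeSet, e ∈ p.edges ∨ e ∈ q.edges := by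
    intro e he
    simp [F] at he
    exact he.1
  have hac : F.IsAcyclic := by
    intro x c hc
    have hcG : ∀ e ∈ c.edges, e ∈ G.edgeSet := by
      intro e he
      rcases hFe e (c.edges_subset_edgeSet he) with h | h
      · exact p.edges_subset_edgeSet h
      · exact q.edges_subset_edgeSet h
    have h1 := hG x _ (hc.transfer hcG)
    rw [Walk.length_transfer] at h1
    have h2 : c.edges.toFinset ⊆ p.edges.toFinset ∪ q.edges.toFinset := by
      intro e he
      simp only [List.mem_toFinset, Finset.mem_union] at he ⊢
      exact hFe e (c.edges_subset_edgeSet he)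
    have h3 := Finset.card_le_card h2
    have h4 := Finset.card_union_le p.edges.toFinset q.edges.toFinset
    rw [List.toFinset_card_of_nodup hc.isTrail.edges_nodup, Walk.length_edges] at h3
    have h5 := p.edges.toFinset_card_le
    have h6 := q.edges.toFinset_card_le
    rw [Walk.length_edges] at h5 h6
    omega
  have := (hac.subsingleton_path u v).elim ⟨_, hp.transfer hpF⟩ ⟨_, hq.transfer hqF⟩
  have h := congrArg Walk.support (congrArg Subtype.val this)
  simp only [Walk.support_transfer] at h
  exact Walk.ext_support h

theorem growth {V : Type*} [Fintype V] [Nonempty V] (G : SimpleGraph V) (δ : ℕ)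
    (hG : LongCycles G (2 * δ)) (hdeg : ∀ v, 5 ≤ (G.neighborSet v).ncard) :
    4 ^ δ ≤ Fintype.card V := by
  classical
  obtain ⟨v⟩ := ‹Nonempty V›
  let L : ℕ → Finset V := fun k =>
    Finset.univ.filter fun w => ∃ p : G.Walk v w, p.IsPath ∧ p.length = k
  have key : ∀ k, k ≤ δ → 4 ^ k ≤ (L k).card := by
    intro k
    induction k with
    | zero =>
      intro _
      have : v ∈ L 0 := by
        simp only [L, Finset.mem_filter, Finset.mem_univ, true_and]
        exact ⟨.nil, by simp, rfl⟩
      simpa using ⟨v, this⟩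
    | succ k ih =>
      intro hk
      have ih := ih (by omega)
      have := Finset.card_mul_le_card_mul (fun w x => G.Adj w x) (s := L k) (t := L (k+1))
        (m := 4) (n := 1) ?_ ?_
      · rw [pow_succ]; omega
      · intro w hw
        simp only [L, Finset.mem_filter, Finset.mem_univ, true_and] at hw
        obtain ⟨p, hp, hpl⟩ := hw
        have hsub : (G.neighborFinset w).erase p.penultimate ⊆
            Finset.bipartiteAbove (fun w x => G.Adj w x) (L (k+1)) w := by
          intro x hx
          simp only [Finset.mem_erase, mem_neighborFinset] at hx
          obtain ⟨hne, hadj⟩ := hx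
          simp only [Finset.mem_bipartiteAbove, L, Finset.mem_filter, Finset.mem_univ, true_and]
          refine ⟨?_, hadj⟩
          have hns : x ∉ p.support := by
            intro hxs
            apply hne
            have hle := p.length_dropUntil_le_length hxs
            have he := path_unique hG (p.dropUntil x hxs) hadj.symm.toWalk
              (hp.dropUntil hxs) (by simp [hadj.ne']) (by simp; omega)
            have h2 := p.take_spec hxs
            rw [he] at h2
            have h3 : (p.takeUntil x hxs).concat hadj.symm = p := by
              rw [Walk.concat_eq_append]; exact h2
            rw [← h3, Walk.penultimate_concat]
          exact ⟨p.concat hadj, hp.concat hns hadj, by simp [hpl]⟩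
        have h1 := Finset.card_le_card hsub
        have h2 := Finset.pred_card_le_card_erase (s := G.neighborFinset w) (a := p.penultimate)
        have h3 := hdeg w
        rw [Set.ncard_eq_toFinset_card'] at h3
        change 5 ≤ (G.neighborFinset w).card at h3
        omega
      · intro x hx
        simp only [L, Finset.mem_filter, Finset.mem_univ, true_and] at hx
        obtain ⟨q, hq, hql⟩ := hx
        have hpen : ∀ w ∈ Finset.bipartiteBelow (fun w x => G.Adj w x) (L k) x,
            w = q.penultimate := by
          intro w hw
          simp only [Finset.mem_bipartiteBelow, L, Finset.mem_filter, Finset.mem_univ,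
            true_and] at hw
          obtain ⟨⟨p, hp, hpl⟩, hadj⟩ := hw
          have hns : x ∉ p.support := by
            intro hxs
            have hle := p.length_takeUntil_le_length hxs
            have he := path_unique hG (p.takeUntil x hxs) q (hp.takeUntil hxs) hq (by omega)
            rw [he] at hle
            omega
          have he := path_unique hG (p.concat hadj) q (hp.concat hns hadj) hq (by simp; omega)
          rw [← he, Walk.penultimate_concat]
        rw [Finset.card_le_one]
        intro a ha b hb
        rw [hpen a ha, hpen b hb]
  exact (key δ le_rfl).trans (Finset.card_le_univ _)

theorem edge_bound (δ : ℕ) (hδ : 1 ≤ δ) (N : ℕ) : ∀ {V : Type*} [Fintype V]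
    (G : SimpleGraph V), Fintype.card V = N → N ≤ 2 ^ δ → LongCycles G (2 * δ) →
    G.edgeSet.ncard ≤ 4 * N := by
  classical
  induction N with
  | zero =>
    intro V _ G hV _ _
    have := Fintype.card_eq_zero_iff.1 hV
    have : G.edgeSet = ∅ := by
      ext e
      induction e with
      | h a b => exact isEmptyElim a
    simp [this]
  | succ N ih =>
    intro V _ G hV hN hG
    have hne : Nonempty V := Fintype.card_pos_iff.1 (by omega)
    by_cases hdeg : ∀ v, 5 ≤ (G.neighborSet v).ncard
    · have h1 := growth G δ hG hdeg
      have h2 : 2 ^ δ < 4 ^ δ := Nat.pow_lt_pow_left (by norm_num) (by omega)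
      omega
    · push Not at hdeg
      obtain ⟨v, hv⟩ := hdeg
      have hc : Fintype.card ({v}ᶜ : Set V) = N := by
        rw [Fintype.card_compl_set]; simp [hV]
      have h1 := ih (G.induce {v}ᶜ) hc (by omega) (by
        intro x c hc
        have := hG _ _ (hc.map (f := (Embedding.induce (G := G) ({v}ᶜ : Set V)).toHom)
          (Embedding.induce (G := G) ({v}ᶜ : Set V)).injective)
        exact this.trans_eq (Walk.length_map _ _))
      have h2 := G.card_edgeFinset_induce_compl_singleton v
      have h3 := G.card_edgeFinset_deleteIncidenceSet v
      rw [Set.ncard_eq_toFinset_card'] at h1 hv ⊢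
      change (G.neighborFinset v).card < 5 at hv
      rw [card_neighborFinset_eq_degree] at hv
      change (G.induce {v}ᶜ).edgeFinset.card ≤ _ at h1
      change G.edgeFinset.card ≤ _
      omega

theorem LongCycles.insert {V : Type*} {G : SimpleGraph V} {k : ℕ} (hG : LongCycles G k)
    {u v : V} (h : ¬ G.Reachable u v ∨ k < G.dist u v) :
    LongCycles (G ⊔ fromEdgeSet {s(u, v)}) k := by
  classical
  intro x c hc
  have hE : ∀ e ∈ c.edges, e ≠ s(u, v) → e ∈ G.edgeSet := by
    intro e he hne
    have := c.edges_subset_edgeSet he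
    simp [edgeSet_sup, hne] at this
    exact this
  by_cases hmem : s(u, v) ∈ c.edges
  · let F : SimpleGraph V := fromEdgeSet {e | e ∈ c.edges}
    have hcF : ∀ e ∈ c.edges, e ∈ F.edgeSet := by
      intro e he
      have := SimpleGraph.not_isDiag_of_mem_edgeSet _ (c.edges_subset_edgeSet he)
      simp [F, he, this]
    have hr := (adj_and_reachable_delete_edges_iff_exists_cycle (G := F) (v := u) (w := v)).2
      ⟨x, c.transfer F hcF, hc.transfer hcF, by simpa using hmem⟩
    obtain ⟨p, hp⟩ := hr.2.exists_isPath
    have hpe : ∀ e ∈ p.edges, e ∈ c.edges ∧ e ≠ s(u, v) := by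
      intro e he
      have := p.edges_subset_edgeSet he
      induction e with
      | h a b =>
        simp [F] at this
        refine ⟨this.1.1, ?_⟩
        intro h
        simp at h
        tauto
    have hpG : ∀ e ∈ p.edges, e ∈ G.edgeSet := fun e he => hE e (hpe e he).1 (hpe e he).2
    have h1 : p.edges.toFinset ⊆ c.edges.toFinset := by
      intro e he
      simp only [List.mem_toFinset] at he ⊢
      exact (hpe e he).1
    have h2 := Finset.card_le_card h1
    rw [List.toFinset_card_of_nodup hp.isTrail.edges_nodup, Walk.length_edges] at h2
    have h3 := c.edges.toFinset_card_le
    rw [Walk.length_edges] at h3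
    rcases h with h | h
    · exact absurd (p.transfer G hpG).reachable h
    · have := dist_le (p.transfer G hpG)
      rw [Walk.length_transfer] at this
      omega
  · have hcG : ∀ e ∈ c.edges, e ∈ G.edgeSet := fun e he => hE e he (by rintro rfl; exact hmem he)
    have := hG x _ (hc.transfer hcG)
    rwa [Walk.length_transfer] at this

theorem LongCycles.mono {V : Type*} {G G' : SimpleGraph V} {k : ℕ} (hG : LongCycles G k)
    (h : G' ≤ G) : LongCycles G' k := by
  intro x c hc
  have := hG x _ (hc.mapLe h)
  simpa using this

end SpannerAux


open scoped Classical in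
/-- The low-recourse dynamic greedy spanner.  `H` evolves from the empty
graph on `n = 2^δ` vertices (`δ = log₂ n`); at each step either nothing changes, an edge
`(u,v)` is inserted because currently `dist_H(u,v) > 2·log₂ n`, or one edge is deleted.
If at most `n` of the steps are deletions, then the total recourse of `H` (number of
edge changes over the whole sequence of `T` steps) is `O(n)`, concretely at most `6n`. -/
theorem low_recourse_spanner {V : Type*} [Fintype V] (n δ : ℕ)
    (hn : Fintype.card V = n) (hδ : 1 ≤ δ) (hpow : n = 2 ^ δ)
    (T : ℕ) (Hs : ℕ → SimpleGraph V) (h0 : Hs 0 = ⊥)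
    (hstep : ∀ t < T,
      Hs (t + 1) = Hs t ∨
      (∃ u v : V, (¬ (Hs t).Reachable u v ∨ 2 * δ < (Hs t).dist u v) ∧
        Hs (t + 1) = Hs t ⊔ SimpleGraph.fromEdgeSet {s(u, v)}) ∨
      (∃ e : Sym2 V, e ∈ (Hs t).edgeSet ∧ Hs (t + 1) = (Hs t).deleteEdges {e}))
    (hdel : ((Finset.range T).filter
        (fun t => ∃ e : Sym2 V, e ∈ (Hs t).edgeSet ∧
          Hs (t + 1) = (Hs t).deleteEdges {e})).card ≤ n) :
    ∑ t ∈ Finset.range T, (symmDiff (Hs (t + 1)).edgeSet (Hs t).edgeSet).ncard ≤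
      6 * n := by
  classical
  have hlong : ∀ t ≤ T, SpannerAux.LongCycles (Hs t) (2 * δ) := by
    intro t
    induction t with
    | zero =>
      intro _
      rw [h0]
      intro x c hc
      exact absurd hc (SimpleGraph.isAcyclic_bot c)
    | succ t ih =>
      intro ht
      have ih := ih (by omega)
      rcases hstep t (by omega) with h | ⟨u, v, huv, h⟩ | ⟨e, he, h⟩
      · rwa [h]
      · rw [h]; exact ih.insert huv
      · rw [h]; exact ih.mono (SimpleGraph.deleteEdges_le _)
  have hsum : ∀ t ≤ T,
      ∑ i ∈ Finset.range t, (symmDiff (Hs (i + 1)).edgeSet (Hs i).edgeSet).ncard ≤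
        (Hs t).edgeSet.ncard + 2 * ((Finset.range t).filter
        (fun t => ∃ e : Sym2 V, e ∈ (Hs t).edgeSet ∧
          Hs (t + 1) = (Hs t).deleteEdges {e})).card := by
    intro t
    induction t with
    | zero => simp
    | succ t ih =>
      intro ht
      have ih := ih (by omega)
      rw [Finset.sum_range_succ, Finset.range_add_one, Finset.filter_insert]
      have hmono : ((Finset.range t).filter
          (fun t => ∃ e : Sym2 V, e ∈ (Hs t).edgeSet ∧
            Hs (t + 1) = (Hs t).deleteEdges {e})).card ≤
          (if ∃ e : Sym2 V, e ∈ (Hs t).edgeSet ∧ Hs (t + 1) = (Hs t).deleteEdges {e} then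
            insert t ((Finset.range t).filter
              (fun t => ∃ e : Sym2 V, e ∈ (Hs t).edgeSet ∧
                Hs (t + 1) = (Hs t).deleteEdges {e}))
          else ((Finset.range t).filter
              (fun t => ∃ e : Sym2 V, e ∈ (Hs t).edgeSet ∧
                Hs (t + 1) = (Hs t).deleteEdges {e}))).card := by
        split_ifs
        · exact Finset.card_le_card (Finset.subset_insert _ _)
        · exact le_rfl
      rcases hstep t (by omega) with h | ⟨u, v, huv, h⟩ | ⟨e, he, h⟩
      · have h1 : (symmDiff (Hs (t + 1)).edgeSet (Hs t).edgeSet).ncard = 0 := by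
          rw [h]; simp
        have h2 : (Hs (t + 1)).edgeSet.ncard = (Hs t).edgeSet.ncard := by rw [h]
        omega
      · have hne : u ≠ v := by
          rintro rfl
          rcases huv with h | h
          · exact h (SimpleGraph.Reachable.refl _)
          · simp at h
        have hnot : s(u, v) ∉ (Hs t).edgeSet := by
          intro hadj
          rw [SimpleGraph.mem_edgeSet] at hadj
          rcases huv with h | h
          · exact h hadj.reachable
          · rw [SimpleGraph.dist_eq_one_iff_adj.2 hadj] at h
            omega
        have hE : (Hs (t + 1)).edgeSet = insert s(u, v) (Hs t).edgeSet := by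
          rw [h, SimpleGraph.edgeSet_sup, SimpleGraph.edgeSet_fromEdgeSet]
          ext e
          simp only [Set.mem_union, Set.mem_sdiff, Set.mem_singleton_iff, Set.mem_insert_iff]
          constructor
          · tauto
          · rintro (rfl | h)
            · right; exact ⟨rfl, by simpa using hne⟩
            · exact Or.inl h
        have h1 : (Hs (t + 1)).edgeSet.ncard = (Hs t).edgeSet.ncard + 1 := by
          rw [hE]; exact Set.ncard_insert_of_notMem hnot (Set.toFinite _)
        have h2 : (symmDiff (Hs (t + 1)).edgeSet (Hs t).edgeSet).ncard ≤ 1 := by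
          rw [hE]
          refine le_of_le_of_eq (Set.ncard_le_ncard ?_ (Set.toFinite _))
            (Set.ncard_singleton s(u, v))
          intro e he
          simp only [Set.mem_symmDiff, Set.mem_insert_iff, Set.mem_singleton_iff] at he ⊢
          tauto
        omega
      · have hE : (Hs (t + 1)).edgeSet = (Hs t).edgeSet \ {e} := by
          rw [h, SimpleGraph.edgeSet_deleteEdges]
        have h1 : (Hs (t + 1)).edgeSet.ncard + 1 = (Hs t).edgeSet.ncard := by
          rw [hE]; exact Set.ncard_sdiff_singleton_add_one he (Set.toFinite _)
        have h2 : (symmDiff (Hs (t + 1)).edgeSet (Hs t).edgeSet).ncard ≤ 1 := by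
          rw [hE]
          refine le_of_le_of_eq (Set.ncard_le_ncard ?_ (Set.toFinite _))
            (Set.ncard_singleton (e))
          intro e he
          simp only [Set.mem_symmDiff, Set.mem_sdiff, Set.mem_singleton_iff] at he ⊢
          tauto
        rw [if_pos ⟨e, he, h⟩, Finset.card_insert_of_notMem (by simp)]
        omega
  have h1 := hsum T le_rfl
  have h2 := SpannerAux.edge_bound δ hδ n (Hs T) hn hpow.le (hlong T le_rfl)
  have h3 : ((Finset.range T).filter
        (fun t => ∃ e : Sym2 V, e ∈ (Hs t).edgeSet ∧
          Hs (t + 1) = (Hs t).deleteEdges {e})).card ≤ n := by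
    convert hdel
  omega
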